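/- Let B, P, k be positive natural numbers with k ≤ 3. Let X be a real B × P matrix with rank X = k (the hyperspectral image unfolded along the spectral mode), let A be a real B × 3 matrix with rank A = 3 (the RGB spectral response, full column rank), and assume the null space of Aᵀ intersects the column space of X trivially (i.e., for every vector v in the column space of X, Aᵀ v = 0 implies v = 0). Let W be a real k × P matrix with rank W = k whose row space equals the row space of the RGB measurement Z = Aᵀ X (as produced by a truncated SVD of Z). Let C : Fin P → (Fin B → ℝ) be the per-pixel mask vectors of the CASSI system, let y : Fin P → ℝ be the CASSI measurement defined by y p = ∑_{b} C p b · X b p, and let Φ : Matrix (Fin B) (Fin k) ℝ →ₗ[ℝ] (Fin P → ℝ) be the linear map (Φ E) p = ∑_{b} C p b · (∑_{j} E b j · W j p). If Φ is injective (the composed sensing matrix Φ^W has full column rank), then there exists a unique real B × k matrix E satisfying Φ E = y, and this E satisfies E * W = X; hence X is exactly reconstructed from the measurements y and Z. -/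

import Mathlib

open Matrix

theorem conditioned_exact_reconstruction
    (B P k : ℕ) (hB : 0 < B) (hP : 0 < P) (hk : 0 < k) (hk3 : k ≤ 3)
    (X : Matrix (Fin B) (Fin P) ℝ) (hX : X.rank = k)
    (A : Matrix (Fin B) (Fin 3) ℝ) (hA : A.rank = 3)
    (hker : ∀ v ∈ LinearMap.range X.mulVecLin, Aᵀ *ᵥ v = 0 → v = 0)
    (W : Matrix (Fin k) (Fin P) ℝ) (hW : W.rank = k)
    (hrow : Submodule.span ℝ (Set.range W) = Submodule.span ℝ (Set.range (Aᵀ * X)))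
    (C : Fin P → Fin B → ℝ)
    (y : Fin P → ℝ) (hy : ∀ p, y p = ∑ b : Fin B, C p b * X b p)
    (Φ : Matrix (Fin B) (Fin k) ℝ →ₗ[ℝ] (Fin P → ℝ))
    (hΦ : ∀ (E : Matrix (Fin B) (Fin k) ℝ) (p : Fin P),
      Φ E p = ∑ b : Fin B, C p b * (∑ j : Fin k, E b j * W j p))
    (hinj : Function.Injective Φ) :
    (∃! E : Matrix (Fin B) (Fin k) ℝ, Φ E = y) ∧
      ∀ E : Matrix (Fin B) (Fin k) ℝ, Φ E = y → E * W = X := by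
  have hle : Submodule.span ℝ (Set.range W) ≤ Submodule.span ℝ (Set.range X) := by
    rw [hrow, Submodule.span_le]
    rintro _ ⟨i, rfl⟩
    have h : (Aᵀ * X) i = ∑ b, Aᵀ i b • X b := by
      ext p
      simp [Matrix.mul_apply, Finset.sum_apply]
    rw [h]
    exact Submodule.sum_mem _ fun b _ =>
      Submodule.smul_mem _ _ (Submodule.subset_span ⟨b, rfl⟩)
  have heq : Submodule.span ℝ (Set.range W) = Submodule.span ℝ (Set.range X) := by
    apply Submodule.eq_of_le_of_finrank_eq hle
    have h1 := Matrix.rank_eq_finrank_span_row W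
    have h2 := Matrix.rank_eq_finrank_span_row X
    exact (h1.symm.trans (hW.trans hX.symm)).trans h2
  have hex : ∀ b, ∃ c : Fin k → ℝ, ∑ j, c j • W j = X b := by
    intro b
    have hb : X b ∈ Submodule.span ℝ (Set.range W) := by
      rw [heq]
      exact Submodule.subset_span ⟨b, rfl⟩
    exact (Submodule.mem_span_range_iff_exists_fun ℝ).1 hb
  choose E hE using hex
  have hEp : ∀ b p, ∑ j, E b j * W j p = X b p := by
    intro b p
    have := congrFun (hE b) p
    simpa [Finset.sum_apply] using this
  have hEW : (Matrix.of E) * W = X := by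
    ext b p
    simpa [Matrix.mul_apply] using hEp b p
  have hΦE : Φ (Matrix.of E) = y := by
    funext p
    rw [hΦ, hy]
    simp [hEp]
  refine ⟨⟨Matrix.of E, hΦE, fun E' h => hinj (h.trans hΦE.symm)⟩, fun E' h => ?_⟩
  rw [hinj (h.trans hΦE.symm)]
  exact hEW
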